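/- For every integer s ≥ 4 and every real ε > 0, there exists n₀ such that for all n ≥ n₀: (C(s-2,2) - ε)·C(n,2) ≤ sat(n, C₄, K_s) ≤ (C(s-2,2) + ε)·C(n,2); that is, the minimum number of copies of C₄ in an n-vertex K_s-saturated graph is (1 + o(1))·(n²(s-2)(s-3))/4. -/

import Mathlib

open SimpleGraph Finset

variable {V : Type*}

/-- The graph `G` with the edge `u v` added. -/
def addEdge (G : SimpleGraph V) (u v : V) : SimpleGraph V :=
  G ⊔ SimpleGraph.fromEdgeSet {s(u, v)}

/-- `G` is `K_s`-saturated: `G` is `K_s`-free and adding any missing edge creates a `K_s`. -/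
def KSat (s : ℕ) (G : SimpleGraph V) : Prop :=
  G.CliqueFree s ∧ ∀ u v : V, u ≠ v → ¬ G.Adj u v → ¬ (addEdge G u v).CliqueFree s

/-- The number of copies of `K_r` in `G`: the number of `r`-sets of vertices inducing
a complete graph. -/
noncomputable def cliqueCount (G : SimpleGraph V) (r : ℕ) : ℕ :=
  {t : Finset V | G.IsNClique r t}.ncard

/-- `sat(n, K_r, K_s)`: minimum number of copies of `K_r` in an `n`-vertex
`K_s`-saturated graph. -/
noncomputable def satCliques (n r s : ℕ) : ℕ :=
  sInf {m | ∃ G : SimpleGraph (Fin n), KSat s G ∧ cliqueCount G r = m}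

/-- The join `K_{s-2} ∗ ∅_{n-s+2}` on `Fin n`. -/
def joinGraph (n s : ℕ) : SimpleGraph (Fin n) :=
  SimpleGraph.fromRel (fun i _ => (i : ℕ) < s - 2)

/-- The number of copies of `C_r` in `G` : the number of subgraphs of `G`
isomorphic to the cycle on `r` vertices. -/
noncomputable def cycleCount (G : SimpleGraph V) (r : ℕ) : ℕ :=
  {H : G.Subgraph | Nonempty (H.coe ≃g cycleGraph r)}.ncard

/-- `sat(n, C_r, K_s)`. -/
noncomputable def satCyclesCliqueSat (n r s : ℕ) : ℕ :=
  sInf {m | ∃ G : SimpleGraph (Fin n), KSat s G ∧ cycleCount G r = m}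

/-- `G` contains a copy of `F`, i.e. a subgraph isomorphic to `F`. -/
def ContainsCopy {α β : Type*} (F : SimpleGraph α) (G : SimpleGraph β) : Prop :=
  ∃ f : α → β, Function.Injective f ∧ ∀ a b : α, F.Adj a b → G.Adj (f a) (f b)

/-- strongly K_s-saturated -/
def StronglyKSat (s : ℕ) (G : SimpleGraph V) : Prop :=
  ∀ u v : V, u ≠ v → ¬ G.Adj u v →
    ∃ t : Finset V, (addEdge G u v).IsNClique s t ∧ u ∈ t ∧ v ∈ t

/-- dumbbell -/
def dumbbell (m : ℕ) : SimpleGraph (Fin (2 * m)) :=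
  SimpleGraph.fromRel (fun i j =>
    ((i : ℕ) < m ∧ (j : ℕ) < m) ∨ (m ≤ (i : ℕ) ∧ m ≤ (j : ℕ)) ∨ ((i : ℕ) = 0 ∧ (j : ℕ) = m))

def Vgraph (m : ℕ) : SimpleGraph (Fin (m + 2)) :=
  SimpleGraph.fromRel (fun i j =>
    ((i : ℕ) < m ∧ (j : ℕ) < m) ∨ ((i : ℕ) = 0 ∧ m ≤ (j : ℕ)))

def lambdaGraph (m : ℕ) : SimpleGraph (Fin (m + 1)) :=
  SimpleGraph.fromRel (fun i j =>
    ((i : ℕ) < m ∧ (j : ℕ) < m) ∨ ((i : ℕ) = m ∧ (j : ℕ) < 2))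

def VgraphGen (m r : ℕ) : SimpleGraph (Fin (m + (m - r))) :=
  SimpleGraph.fromRel (fun i j =>
    ((i : ℕ) < m ∧ (j : ℕ) < m) ∨
      (((i : ℕ) = 0 ∨ m ≤ (i : ℕ)) ∧ ((j : ℕ) = 0 ∨ m ≤ (j : ℕ))))

def lambdaGraphGen (m r : ℕ) : SimpleGraph (Fin (m + 1)) :=
  SimpleGraph.fromRel (fun i j =>
    ((i : ℕ) < m ∧ (j : ℕ) < m) ∨ ((i : ℕ) = m ∧ (j : ℕ) < r))

/-- `G` is saturated with respect to the family `{F₁, F₂, F₃}`. -/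
def FamSat3 {α₁ α₂ α₃ : Type*} (F₁ : SimpleGraph α₁) (F₂ : SimpleGraph α₂)
    (F₃ : SimpleGraph α₃) (G : SimpleGraph V) : Prop :=
  ¬ ContainsCopy F₁ G ∧ ¬ ContainsCopy F₂ G ∧ ¬ ContainsCopy F₃ G ∧
    ∀ u v : V, u ≠ v → ¬ G.Adj u v →
      ContainsCopy F₁ (addEdge G u v) ∨ ContainsCopy F₂ (addEdge G u v) ∨
        ContainsCopy F₃ (addEdge G u v)

noncomputable def satFam3 {α₁ α₂ α₃ : Type*} (n : ℕ) (F₁ : SimpleGraph α₁)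
    (F₂ : SimpleGraph α₂) (F₃ : SimpleGraph α₃) : ℕ :=
  sInf {m | ∃ G : SimpleGraph (Fin n), FamSat3 F₁ F₂ F₃ G ∧ G.edgeSet.ncard = m}

noncomputable def satCliquesFam3 {α₁ α₂ α₃ : Type*} (n r : ℕ) (F₁ : SimpleGraph α₁)
    (F₂ : SimpleGraph α₂) (F₃ : SimpleGraph α₃) : ℕ :=
  sInf {m | ∃ G : SimpleGraph (Fin n), FamSat3 F₁ F₂ F₃ G ∧ cliqueCount G r = m}

/-- saturation w.r.t. a single graph, with copies as subgraphs. -/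
def SatGraph {α : Type*} (F : SimpleGraph α) (G : SimpleGraph V) : Prop :=
  ¬ ContainsCopy F G ∧ ∀ u v : V, u ≠ v → ¬ G.Adj u v → ContainsCopy F (addEdge G u v)

noncomputable def satCyclesGraphSat {α : Type*} (n r : ℕ) (F : SimpleGraph α) : ℕ :=
  sInf {m | ∃ G : SimpleGraph (Fin n), SatGraph F G ∧ cycleCount G r = m}

/-- number of independent sets of size l -/
noncomputable def indepCount (G : SimpleGraph V) (l : ℕ) : ℕ :=
  {t : Finset V | t.card = l ∧ ∀ a ∈ t, ∀ b ∈ t, ¬ G.Adj a b}.ncard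

/-- Ramsey number -/
noncomputable def ramsey (l s : ℕ) : ℕ :=
  sInf {N | ∀ G : SimpleGraph (Fin N),
    (∃ t : Finset (Fin N), t.card = l ∧ ∀ a ∈ t, ∀ b ∈ t, ¬ G.Adj a b) ∨
      ∃ t : Finset (Fin N), G.IsNClique s t}

theorem copy_natCard {W : Type*} (A : SimpleGraph W) (G : SimpleGraph V) :
    Nat.card (Copy A G) =
      {H : G.Subgraph | Nonempty (H.coe ≃g A)}.ncard * Nat.card (A ≃g A) := by
  rw [← Nat.card_coe_set_eq, ← Nat.card_prod]
  symm
  let F : {H : G.Subgraph | Nonempty (H.coe ≃g A)} × (A ≃g A) → Copy A G := fun p =>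
    p.1.1.coeCopy.comp (p.1.2.some.symm.toCopy.comp (Iso.toCopy p.2))
  have hF : ∀ p, (F p).toSubgraph = p.1.1 := by
    rintro ⟨⟨H, hH⟩, e⟩
    have : (F ⟨⟨H, hH⟩, e⟩).toHom = H.hom.comp (hH.some.symm.toHom.comp (Iso.toHom e)) := rfl
    simp [Copy.toSubgraph, this, Subgraph.map_comp]
  refine Nat.card_eq_of_bijective F ⟨?_, ?_⟩
  · rintro ⟨H, e⟩ ⟨H', e'⟩ h
    obtain rfl : H = H' := Subtype.ext (by rw [← hF ⟨H, e⟩, h, hF])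
    congr 1
    ext a
    have h1 : (F ⟨H, e⟩) a = (F ⟨H, e'⟩) a := by rw [h]
    exact H.2.some.symm.injective (Subtype.ext h1)
  · intro f
    have hf : Nonempty (f.toSubgraph.coe ≃g A) := ⟨f.isoToSubgraph.symm⟩
    refine ⟨⟨⟨f.toSubgraph, hf⟩, f.isoToSubgraph.trans hf.some⟩, ?_⟩
    ext a
    change ((hf.some.symm (hf.some (f.isoToSubgraph a)) : f.toSubgraph.verts) : V) = f a
    rw [RelIso.symm_apply_apply]
    rfl

theorem natCard_cycleGraph_four_iso :
    Nat.card (cycleGraph 4 ≃g cycleGraph 4) = 8 := by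
  have e : (cycleGraph 4 ≃g cycleGraph 4) ≃
      {σ : Equiv.Perm (Fin 4) // ∀ a b : Fin 4,
        (σ a - σ b = 1 ∨ σ b - σ a = 1) ↔ (a - b = 1 ∨ b - a = 1)} :=
    { toFun := fun f => ⟨f.toEquiv, fun a b => by
        have := f.map_adj_iff (v := a) (w := b)
        rwa [cycleGraph_adj, cycleGraph_adj] at this⟩
      invFun := fun σ => ⟨σ.1, fun {a b} => by
        rw [cycleGraph_adj, cycleGraph_adj]
        exact σ.2 a b⟩
      left_inv := fun _ => rfl
      right_inv := fun _ => rfl }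
  rw [Nat.card_congr e, Nat.card_eq_fintype_card]
  decide +kernel

open Classical in
/-- The labelled 4-cycles of `G`, recorded as the two ordered pairs of opposite vertices. -/
noncomputable def labelledC4 [Fintype V] (G : SimpleGraph V) : Finset ((V × V) × (V × V)) :=
  {p | p.1.1 ≠ p.1.2 ∧ p.2.1 ≠ p.2.2 ∧
    (G.Adj p.1.1 p.2.1 ∧ G.Adj p.1.1 p.2.2) ∧ (G.Adj p.1.2 p.2.1 ∧ G.Adj p.1.2 p.2.2)}

theorem natCard_copy_cycleGraph_four [Fintype V] (G : SimpleGraph V) :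
    Nat.card (Copy (cycleGraph 4) G) = #(labelledC4 G) := by
  rw [← Fintype.card_coe, ← Nat.card_eq_fintype_card]
  have h01 : (cycleGraph 4).Adj 0 1 := by decide
  have h03 : (cycleGraph 4).Adj 0 3 := by decide
  have h21 : (cycleGraph 4).Adj 2 1 := by decide
  have h23 : (cycleGraph 4).Adj 2 3 := by decide
  refine Nat.card_eq_of_bijective
    (fun f : Copy (cycleGraph 4) G => ⟨((f 0, f 2), (f 1, f 3)), ?_⟩) ⟨?_, ?_⟩
  · simp only [labelledC4, mem_filter, mem_univ, true_and]
    exact ⟨f.injective.ne (by decide), f.injective.ne (by decide),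
      ⟨f.toHom.map_adj h01, f.toHom.map_adj h03⟩, ⟨f.toHom.map_adj h21, f.toHom.map_adj h23⟩⟩
  · intro f g h
    simp only [Subtype.mk.injEq, Prod.mk.injEq] at h
    ext i
    fin_cases i
    exacts [h.1.1, h.2.1, h.1.2, h.2.2]
  · rintro ⟨⟨⟨a, c⟩, ⟨b, d⟩⟩, hp⟩
    simp only [labelledC4, mem_filter, mem_univ, true_and] at hp
    obtain ⟨hac, hbd, ⟨hab, had⟩, hcb, hcd⟩ := hp
    refine ⟨⟨⟨![a, b, c, d], ?_⟩, ?_⟩, rfl⟩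
    · intro i j hij
      rw [cycleGraph_adj] at hij
      fin_cases i <;> fin_cases j <;>
        first
          | exact absurd hij (by decide)
          | assumption
          | (apply Adj.symm; assumption)
    · intro i j hij
      have := hab.ne
      have := had.ne
      have := hcb.ne
      have := hcd.ne
      fin_cases i <;> fin_cases j <;> simp_all

theorem eight_mul_cycleCount [Fintype V] (G : SimpleGraph V) :
    8 * cycleCount G 4 = #(labelledC4 G) := by
  rw [← natCard_copy_cycleGraph_four, copy_natCard, natCard_cycleGraph_four_iso, mul_comm]
  rfl

theorem addEdge_adj (G : SimpleGraph V) {u v a b : V} :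
    (addEdge G u v).Adj a b ↔ G.Adj a b ∨ (s(a, b) = s(u, v) ∧ a ≠ b) := by
  simp only [addEdge, SimpleGraph.sup_adj, SimpleGraph.fromEdgeSet_adj, Set.mem_singleton_iff]

theorem joinGraph_adj {n s : ℕ} {i j : Fin n} :
    (joinGraph n s).Adj i j ↔ i ≠ j ∧ ((i : ℕ) < s - 2 ∨ (j : ℕ) < s - 2) := by
  simp [joinGraph]

theorem card_filter_lt_join {n s : ℕ} (h : s ≤ n) :
    #({i | (i : ℕ) < s - 2} : Finset (Fin n)) = s - 2 := by
  rw [Fin.card_filter_val_lt]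
  omega

theorem joinGraph_kSat {n s : ℕ} (hs : 2 ≤ s) (h : s ≤ n) : KSat s (joinGraph n s) := by
  set S : Finset (Fin n) := {i | (i : ℕ) < s - 2} with hS
  have hc : #S = s - 2 := card_filter_lt_join h
  constructor
  · intro t ht
    have h1 : 1 < #(t \ S) := by
      have := Finset.le_card_sdiff S t
      have := ht.card_eq
      omega
    obtain ⟨a, ha, b, hb, hab⟩ := Finset.one_lt_card.1 h1
    rw [Finset.mem_sdiff] at ha hb
    have := ht.isClique ha.1 hb.1 hab
    rw [joinGraph_adj] at this
    simp [hS] at ha hb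
    omega
  · intro u v huv hn hfree
    rw [joinGraph_adj] at hn
    have hu : ¬ (u : ℕ) < s - 2 := by tauto
    have hv : ¬ (v : ℕ) < s - 2 := by tauto
    refine hfree (insert u (insert v S)) ⟨?_, ?_⟩
    · intro a ha b hb hab
      rw [addEdge_adj, joinGraph_adj]
      simp only [hS, coe_insert, coe_filter, Set.mem_insert_iff, Set.mem_ofPred_eq, mem_univ,
        true_and] at ha hb
      rcases ha with rfl | rfl | ha <;> rcases hb with rfl | rfl | hb <;> simp_all
    · rw [card_insert_of_notMem, card_insert_of_notMem, hc]
      · omega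
      · simpa [hS] using hv
      · simpa [hS, huv] using hu

theorem card_labelledC4_joinGraph_le {n s : ℕ} (h : s ≤ n) :
    #(labelledC4 (joinGraph n s)) ≤ 2 * ((n * n - n) * ((s - 2) * (s - 2) - (s - 2))) := by
  classical
  set S : Finset (Fin n) := {i | (i : ℕ) < s - 2} with hS
  have hc : #S = s - 2 := card_filter_lt_join h
  have hsub : labelledC4 (joinGraph n s) ⊆
      (univ : Finset (Fin n)).offDiag ×ˢ S.offDiag ∪ S.offDiag ×ˢ univ.offDiag := by
    rintro ⟨⟨a, c⟩, ⟨b, d⟩⟩ hp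
    simp only [labelledC4, mem_filter, joinGraph_adj, mem_univ, true_and] at hp
    simp only [mem_union, mem_product, mem_offDiag, hS, mem_filter, mem_univ, true_and]
    tauto
  refine (card_le_card hsub).trans ((card_union_le _ _).trans ?_)
  rw [card_product, card_product, offDiag_card, offDiag_card, hc, card_univ, Fintype.card_fin,
    mul_comm ((s - 2) * (s - 2) - (s - 2)), two_mul]

theorem KSat.exists_clique_common {s : ℕ} {G : SimpleGraph V} (hG : KSat s G)
    {u v : V} (huv : u ≠ v) (hn : ¬ G.Adj u v) :
    ∃ t : Finset V, #t = s - 2 ∧ ∀ b ∈ t, G.Adj u b ∧ G.Adj v b ∧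
      ∀ d ∈ t, b ≠ d → G.Adj b d := by
  classical
  have h := hG.2 u v huv hn
  simp only [CliqueFree, not_forall, not_not] at h
  obtain ⟨t, ht⟩ := h
  have hadj : ∀ a ∈ t, ∀ b ∈ t, a ≠ b → s(a, b) ≠ s(u, v) → G.Adj a b := by
    intro a ha b hb hab hne
    have := ht.isClique ha hb hab
    rw [addEdge_adj] at this
    tauto
  have huvt : u ∈ t ∧ v ∈ t := by
    by_contra hcon
    refine hG.1 t ⟨fun a ha b hb hab => hadj a ha b hb hab ?_, ht.card_eq⟩
    intro he
    rcases Sym2.eq_iff.1 he with ⟨rfl, rfl⟩ | ⟨rfl, rfl⟩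
    · exact hcon ⟨ha, hb⟩
    · exact hcon ⟨hb, ha⟩
  obtain ⟨hu, hv⟩ := huvt
  refine ⟨(t.erase u).erase v, ?_, ?_⟩
  · rw [card_erase_of_mem (by simp [hv, huv.symm]), card_erase_of_mem hu, ht.card_eq]
    omega
  · intro b hb
    simp only [mem_erase] at hb
    obtain ⟨hbv, hbu, hb⟩ := hb
    refine ⟨hadj u hu b hb (Ne.symm hbu) ?_, hadj v hv b hb (Ne.symm hbv) ?_, ?_⟩
    · simp [hbv, huv]
    · simp [hbu, huv.symm]
    · intro d hd hbd
      simp only [mem_erase] at hd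
      refine hadj b hb d hd.2.2 hbd ?_
      simp [hbu, hbv]

open Classical in
/-- The ordered pairs of adjacent vertices. -/
noncomputable def adjPairs [Fintype V] (G : SimpleGraph V) : Finset (V × V) :=
  {p | G.Adj p.1 p.2}

open Classical in
/-- The ordered pairs of distinct nonadjacent vertices. -/
noncomputable def nonadjPairs [Fintype V] (G : SimpleGraph V) : Finset (V × V) :=
  {p | p.1 ≠ p.2 ∧ ¬ G.Adj p.1 p.2}

theorem card_nonadjPairs_add [Fintype V] (G : SimpleGraph V) :
    #(nonadjPairs G) + #(adjPairs G) = Fintype.card V * Fintype.card V - Fintype.card V := by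
  classical
  rw [← card_univ, ← offDiag_card, ← card_union_of_disjoint]
  · congr 1
    ext ⟨a, b⟩
    simp only [nonadjPairs, adjPairs, mem_union, mem_filter, mem_univ, true_and, mem_offDiag]
    have := fun h : G.Adj a b => h.ne
    tauto
  · rw [Finset.disjoint_left]
    rintro ⟨a, b⟩ h1 h2
    simp [nonadjPairs, adjPairs] at h1 h2
    tauto

theorem card_offDiag_le_fiber_labelledC4 [Fintype V] [DecidableEq V] (G : SimpleGraph V)
    {p : V × V} (hp : p.1 ≠ p.2) {t : Finset V} (ht : ∀ b ∈ t, G.Adj p.1 b ∧ G.Adj p.2 b) :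
    #t * #t - #t ≤ #{x ∈ labelledC4 G | x.1 = p ∧ x.2 ∈ t.offDiag} := by
  rw [← offDiag_card]
  refine card_le_card_of_injOn (fun q => (p, q)) ?_ fun q _ q' _ h => congrArg Prod.snd h
  intro q hq
  have hq' := mem_offDiag.1 (mem_coe.1 hq)
  simp only [labelledC4, coe_filter, Set.mem_ofPred_eq, mem_filter, mem_univ, true_and]
  have h1 := ht _ hq'.1
  have h2 := ht _ hq'.2.1
  exact ⟨⟨hp, hq'.2.2, ⟨h1.1, h2.1⟩, h1.2, h2.2⟩, mem_coe.1 hq⟩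

theorem KSat.two_mul_card_nonadjPairs_le [Fintype V] {s : ℕ} {G : SimpleGraph V}
    (hG : KSat s G) :
    2 * (#(nonadjPairs G) * ((s - 2) * (s - 2) - (s - 2))) ≤ #(labelledC4 G) := by
  classical
  set L : Finset ((V × V) × (V × V)) :=
    (labelledC4 G).filter fun p => ¬ G.Adj p.1.1 p.1.2 ∧ G.Adj p.2.1 p.2.2 with hL
  set R : Finset ((V × V) × (V × V)) :=
    (labelledC4 G).filter fun p => ¬ G.Adj p.2.1 p.2.2 ∧ G.Adj p.1.1 p.1.2 with hR
  have hLR : #L = #R := by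
    refine card_bij (fun p _ => p.swap) ?_ ?_ ?_
    · rintro ⟨⟨a, c⟩, ⟨b, d⟩⟩ hp
      simp only [hL, hR, labelledC4, mem_filter, mem_univ, true_and, Prod.swap] at hp ⊢
      have := G.adj_comm a b
      have := G.adj_comm a d
      have := G.adj_comm c b
      have := G.adj_comm c d
      tauto
    · intro p _ q _ h
      exact Prod.swap_injective h
    · rintro ⟨⟨a, c⟩, ⟨b, d⟩⟩ hp
      refine ⟨((b, d), (a, c)), ?_, rfl⟩
      simp only [hL, hR, labelledC4, mem_filter, mem_univ, true_and] at hp ⊢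
      have := G.adj_comm a b
      have := G.adj_comm a d
      have := G.adj_comm c b
      have := G.adj_comm c d
      tauto
  have hdisj : Disjoint L R := by
    rw [Finset.disjoint_left]
    intro p h1 h2
    simp only [hL, hR, mem_filter] at h1 h2
    tauto
  have hunion : #L + #R ≤ #(labelledC4 G) := by
    rw [← card_union_of_disjoint hdisj]
    exact card_le_card (union_subset (filter_subset _ _) (filter_subset _ _))
  have hmain : #(nonadjPairs G) * ((s - 2) * (s - 2) - (s - 2)) ≤ #L := by
    rw [mul_comm]
    refine mul_card_image_le_card_of_maps_to (f := Prod.fst) ?_ _ ?_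
    · intro p hp
      simp only [hL, labelledC4, nonadjPairs, mem_filter, mem_univ, true_and] at hp ⊢
      tauto
    · intro p hp
      simp only [nonadjPairs, mem_filter, mem_univ, true_and] at hp
      obtain ⟨t, htc, ht⟩ := hG.exists_clique_common hp.1 hp.2
      rw [← htc]
      refine (card_offDiag_le_fiber_labelledC4 G hp.1
        fun b hb => ⟨(ht b hb).1, (ht b hb).2.1⟩).trans (card_le_card ?_)
      intro x hx
      simp only [hL, mem_filter, mem_offDiag] at hx ⊢
      obtain ⟨hx, rfl, hb, hd, hbd⟩ := hx
      exact ⟨⟨hx, hp.2, (ht _ hb).2.2 _ hd hbd⟩, rfl⟩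
  omega

theorem sum_sq_le_labelledC4 [Fintype V] (G : SimpleGraph V) :
    (#(adjPairs G) : ℝ) ^ 2 ≤
      Fintype.card V * (#(labelledC4 G) + 2 * (Fintype.card V : ℝ) ^ 2) := by
  classical
  set n := Fintype.card V
  set N : V × V → Finset V := fun p => {w | G.Adj p.1 w ∧ G.Adj p.2 w} with hN
  have hD : #(adjPairs G) = ∑ w, #{a | G.Adj w a} := by
    simp only [adjPairs, card_filter, Fintype.sum_prod_type]
  have hcauchy : #(adjPairs G) ^ 2 ≤ n * ∑ w, #{a | G.Adj w a} ^ 2 := by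
    rw [hD]
    exact sq_sum_le_card_mul_sum_sq
  have hsq : ∑ w, #{a | G.Adj w a} ^ 2 = ∑ p, #(N p) := by
    simp only [hN, card_filter, sq, sum_mul_sum, Fintype.sum_prod_type]
    rw [sum_comm]
    refine sum_congr rfl fun a _ => ?_
    rw [sum_comm]
    refine sum_congr rfl fun c _ => sum_congr rfl fun w _ => ?_
    simp only [ite_and, ite_mul, one_mul, zero_mul, G.adj_comm w]
  have hfib : ∑ p ∈ univ.offDiag, (#(N p) * #(N p) - #(N p)) ≤ #(labelledC4 G) := by
    rw [card_eq_sum_card_fiberwise (f := Prod.fst) (t := univ.offDiag)]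
    · refine sum_le_sum fun p hp => ?_
      refine (card_offDiag_le_fiber_labelledC4 G (mem_offDiag.1 hp).2.2
        fun b hb => (mem_filter.1 hb).2).trans (card_le_card ?_)
      exact fun x hx => by
        rw [mem_filter] at hx ⊢
        exact ⟨hx.1, hx.2.1⟩
    · intro p hp
      simp only [labelledC4, coe_filter, mem_univ, true_and, Set.mem_ofPred_eq] at hp
      simp [hp.1]
  have hoff : ∑ p ∈ univ.offDiag, #(N p) ≤ #(labelledC4 G) + n * n := by
    calc ∑ p ∈ univ.offDiag, #(N p)
        ≤ ∑ p ∈ (univ : Finset V).offDiag, ((#(N p) * #(N p) - #(N p)) + 1) := by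
          refine sum_le_sum fun p _ => ?_
          rcases Nat.lt_or_ge #(N p) 2 with h | h
          · omega
          · have := Nat.mul_le_mul_right #(N p) h
            omega
      _ ≤ #(labelledC4 G) + n * n := by
          rw [sum_add_distrib, sum_const, smul_eq_mul, mul_one, offDiag_card, card_univ]
          exact add_le_add hfib (Nat.sub_le _ _)
  have hdiag : ∑ p ∈ univ.diag, #(N p) ≤ n * n := by
    refine (sum_le_card_nsmul _ _ n fun p _ => card_le_univ _).trans ?_
    rw [diag_card, card_univ, smul_eq_mul]
  have htot : ∑ p, #(N p) ≤ #(labelledC4 G) + 2 * n ^ 2 := by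
    rw [← univ_product_univ, ← diag_union_offDiag, sum_union (disjoint_diag_offDiag _)]
    nlinarith
  have := hcauchy.trans (Nat.mul_le_mul_left n (hsq.trans_le htot))
  exact_mod_cast this

theorem sat_C4_asymptotics (s : ℕ) (hs : 4 ≤ s) (ε : ℝ) (hε : 0 < ε) :
    ∃ n₀ : ℕ, ∀ n ≥ n₀,
      (((s - 2).choose 2 : ℝ) - ε) * (n.choose 2 : ℝ) ≤ (satCyclesCliqueSat n 4 s : ℝ) ∧
      (satCyclesCliqueSat n 4 s : ℝ) ≤ (((s - 2).choose 2 : ℝ) + ε) * (n.choose 2 : ℝ) := by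
  have cast_sq_sub (m : ℕ) : ((m * m - m : ℕ) : ℝ) = 2 * (m.choose 2 : ℝ) := by
    rw [Nat.cast_choose_two, Nat.cast_sub (Nat.le_mul_self m)]
    push_cast
    ring
  set K : ℝ := ((s - 2).choose 2 : ℝ) with hK
  have hK1 : 1 ≤ K := by
    have : 0 < (s - 2).choose 2 := Nat.choose_pos (by omega)
    rw [hK]
    exact_mod_cast this
  obtain ⟨N, hN⟩ := exists_nat_gt ((8 * K + 2) * (2 * K / ε) ^ 2 * 4)
  refine ⟨max s N, fun n hn => ?_⟩
  have hsn : s ≤ n := (le_max_left _ _).trans hn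
  have hNn : (N : ℝ) ≤ n := by exact_mod_cast (le_max_right _ _).trans hn
  have hjoin := joinGraph_kSat (by omega : 2 ≤ s) hsn
  constructor
  · obtain ⟨G, hG, hGm⟩ : satCyclesCliqueSat n 4 s ∈
        {m | ∃ G : SimpleGraph (Fin n), KSat s G ∧ cycleCount G 4 = m} :=
      Nat.sInf_mem ⟨_, _, hjoin, rfl⟩
    rw [← hGm]
    have h8 : (8 : ℝ) * cycleCount G 4 = #(labelledC4 G) := by
      exact_mod_cast eight_mul_cycleCount G
    have hA : (#(nonadjPairs G) : ℝ) + #(adjPairs G) = 2 * (n.choose 2 : ℝ) := by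
      rw [← cast_sq_sub]
      have := card_nonadjPairs_add G
      rw [Fintype.card_fin] at this
      exact_mod_cast this
    have hB : 2 * ((#(nonadjPairs G) : ℝ) * (2 * K)) ≤ #(labelledC4 G) := by
      rw [hK, ← cast_sq_sub]
      exact_mod_cast hG.two_mul_card_nonadjPairs_le
    have hC := sum_sq_le_labelledC4 G
    rw [Fintype.card_fin] at hC
    set D : ℝ := ((#(adjPairs G) : ℕ) : ℝ)
    set T : ℝ := ((#(labelledC4 G) : ℕ) : ℝ)
    set c : ℝ := ((cycleCount G 4 : ℕ) : ℝ)
    set M : ℝ := ((n.choose 2 : ℕ) : ℝ) with hM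
    have hn4 : (4 : ℝ) ≤ n := by exact_mod_cast hs.trans hsn
    have hMn : M = n * (n - 1) / 2 := by rw [hM, Nat.cast_choose_two]
    by_cases hD : K * D ≤ 2 * ε * M
    · nlinarith
    · push Not at hD
      have hM4 : (n : ℝ) ^ 2 / 4 ≤ M := by rw [hMn]; nlinarith
      have hMle : M ≤ (n : ℝ) ^ 2 := by rw [hMn]; nlinarith
      have hKpos : 0 < K := by linarith
      have hD2 : ε * (n : ℝ) ^ 2 / (2 * K) ≤ D := by
        rw [div_le_iff₀ (by positivity)]
        nlinarith
      have hD3 : (ε * (n : ℝ) ^ 2 / (2 * K)) ^ 2 ≤ D ^ 2 := by gcongr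
      have hn3 : (8 * K + 2) * (n : ℝ) ^ 2 ≤ (ε / (2 * K)) ^ 2 * (n : ℝ) ^ 3 := by
        have h1 : (8 * K + 2) * (2 * K / ε) ^ 2 ≤ n := by
          have : 0 ≤ (8 * K + 2) * (2 * K / ε) ^ 2 := by positivity
          linarith
        have h2 : (8 * K + 2) ≤ (ε / (2 * K)) ^ 2 * n := by
          have := mul_le_mul_of_nonneg_left h1 (sq_nonneg (ε / (2 * K)))
          refine le_trans (le_of_eq ?_) this
          field_simp
        have := mul_le_mul_of_nonneg_right h2 (sq_nonneg (n : ℝ))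
        linarith
      have hfin : (8 * K + 2) * (n : ℝ) ^ 2 ≤ T + 2 * (n : ℝ) ^ 2 := by
        refine hn3.trans ?_
        have hnpos : (0 : ℝ) < n := by linarith
        refine le_of_mul_le_mul_left ?_ hnpos
        refine le_trans (le_of_eq ?_) (hD3.trans hC)
        ring
      nlinarith
  · have hle : satCyclesCliqueSat n 4 s ≤ cycleCount (joinGraph n s) 4 :=
      Nat.sInf_le ⟨_, hjoin, rfl⟩
    have h8 := eight_mul_cycleCount (joinGraph n s)
    have hT := card_labelledC4_joinGraph_le hsn
    rw [← h8] at hT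
    have hT' : (8 : ℝ) * cycleCount (joinGraph n s) 4 ≤
        2 * ((2 * (n.choose 2 : ℝ)) * (2 * K)) := by
      rw [hK, ← cast_sq_sub, ← cast_sq_sub]
      exact_mod_cast hT
    have hle' : (satCyclesCliqueSat n 4 s : ℝ) ≤ cycleCount (joinGraph n s) 4 := by
      exact_mod_cast hle
    have : 0 ≤ ε * (n.choose 2 : ℝ) := by positivity
    nlinarith
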